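/- arXiv:2312.05914 — 3 statements merged into one kernel-verified Lean document; each statement's English description precedes it below -/
import Mathlib

section
/- Let R be a commutative Noetherian local ring, let M and N be nonzero finitely generated R-modules, and let x = x_1, …, x_s be an N-regular sequence contained in the maximal ideal of R. If Hom_R(M,N) ≠ 0 and Ext_R^i(M,N) = 0 for all 1 ≤ i ≤ s, then x is a Hom_R(M,N)-regular sequence and there is an isomorphism Hom_R(M, N/xN) ≅ Hom_R(M,N)/x·Hom_R(M,N). -/
open CategoryTheory

noncomputable section

/-- The `i`-th Ext module of two `R`-modules. -/
def extMod (R : Type) [CommRing R] (i : ℕ) (M N : Type) [AddCommGroup M] [Module R M]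
    [AddCommGroup N] [Module R N] : ModuleCat R :=
  ((Ext R (ModuleCat R) i).obj (Opposite.op (ModuleCat.of R M))).obj (ModuleCat.of R N)

/-- The `i`-th Tor module of two `R`-modules. -/
def torMod (R : Type) [CommRing R] (i : ℕ) (M N : Type) [AddCommGroup M] [Module R M]
    [AddCommGroup N] [Module R N] : ModuleCat R :=
  ((Tor (ModuleCat R) i).obj (ModuleCat.of R M)).obj (ModuleCat.of R N)

/-- The depth of a module over a local ring: the infimum of the set of
indices `i` with `Ext^i(R/𝔪, N) ≠ 0`. -/
def moduleDepth (R : Type) [CommRing R] [IsLocalRing R] (N : Type) [AddCommGroup N]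
    [Module R N] : ℕ :=
  sInf {i : ℕ | ¬ Subsingleton (extMod R i (R ⧸ IsLocalRing.maximalIdeal R) N)}

/-- An `R`-module `N` has finite injective dimension iff there is an `n` such that
`Ext^i(M, N) = 0` for all modules `M` and all `i > n`. -/
def HasFiniteInjDim (R : Type) [CommRing R] (N : Type) [AddCommGroup N] [Module R N] : Prop :=
  ∃ n : ℕ, ∀ (M : Type) [AddCommGroup M] [Module R M], ∀ i : ℕ, n < i →
    Subsingleton (extMod R i M N)

/-- An `R`-module `M` has finite projective dimension iff there is an `n` such that
`Ext^i(M, N) = 0` for all modules `N` and all `i > n`. -/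
def HasFiniteProjDim (R : Type) [CommRing R] (M : Type) [AddCommGroup M] [Module R M] : Prop :=
  ∃ n : ℕ, ∀ (N : Type) [AddCommGroup N] [Module R N], ∀ i : ℕ, n < i →
    Subsingleton (extMod R i M N)

/-- The `𝔪`-torsion submodule `Γ_𝔪(M)` of a module over a local ring. -/
def mTorsion (R : Type) [CommRing R] [IsLocalRing R] (M : Type) [AddCommGroup M]
    [Module R M] : Submodule R M :=
  ⨆ n : ℕ, Submodule.torsionBySet R M ((IsLocalRing.maximalIdeal R ^ n : Ideal R) : Set R)

/-- A semidualizing module: the natural map `R → Hom(C,C)` is bijective and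
`Ext^i(C,C) = 0` for all `i ≥ 1`. -/
structure IsSemidualizing (R : Type) [CommRing R] (C : Type) [AddCommGroup C]
    [Module R C] : Prop where
  bijective : Function.Bijective (LinearMap.lsmul R C)
  ext_vanish : ∀ i : ℕ, 1 ≤ i → Subsingleton (extMod R i C C)

/-- Membership in the Auslander class `A_C(R)`: the natural map `M → Hom(C, C ⊗ M)` is
bijective, `Tor_i(C, M) = 0` and `Ext^i(C, C ⊗ M) = 0` for all `i ≥ 1`. -/
structure MemAuslanderClass (R : Type) [CommRing R] (C : Type) [AddCommGroup C] [Module R C]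
    (M : Type) [AddCommGroup M] [Module R M] : Prop where
  bijective : Function.Bijective ((TensorProduct.mk R C M).flip)
  tor_vanish : ∀ i : ℕ, 1 ≤ i → Subsingleton (torMod R i C M)
  ext_vanish : ∀ i : ℕ, 1 ≤ i → Subsingleton (extMod R i C (TensorProduct R C M))

/-- A module `N` is Tor-rigid if for every finitely generated module `M` and every `i ≥ 1`,
`Tor_i(M, N) = 0` implies `Tor_{i+1}(M, N) = 0`. -/
def IsTorRigid (R : Type) [CommRing R] (N : Type) [AddCommGroup N] [Module R N] : Prop :=
  ∀ (M : Type) [AddCommGroup M] [Module R M], Module.Finite R M →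
    ∀ i : ℕ, 1 ≤ i → Subsingleton (torMod R i M N) → Subsingleton (torMod R (i + 1) M N)

/-- The natural map `C ⊗ Hom(M,N) → Hom(M, C ⊗ N)`, sending `c ⊗ φ` to `m ↦ c ⊗ φ m`. -/
def homTensorMap (R : Type) [CommRing R] (C M N : Type) [AddCommGroup C] [Module R C]
    [AddCommGroup M] [Module R M] [AddCommGroup N] [Module R N] :
    TensorProduct R C (M →ₗ[R] N) →ₗ[R] (M →ₗ[R] TensorProduct R C N) :=
  TensorProduct.lift
    ((LinearMap.llcomp R M N (TensorProduct R C N)).comp (TensorProduct.mk R C N))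

section

open scoped Pointwise

/-- Division by a regular element: a linear map with values in `x • N` is `x` times a linear map. -/
lemma exists_smul_eq_of_mkQ_comp_eq_zero {R P N : Type*} [CommRing R] [AddCommGroup P] [Module R P]
    [AddCommGroup N] [Module R N] {x : R} (hx : IsSMulRegular N x) (f : P →ₗ[R] N)
    (hf : (x • (⊤ : Submodule R N)).mkQ ∘ₗ f = 0) : ∃ g : P →ₗ[R] N, x • g = f := by
  have hmem (p : P) : ∃ n : N, x • n = f p := by
    have hp := LinearMap.congr_fun hf p
    rw [LinearMap.comp_apply, LinearMap.zero_apply, Submodule.mkQ_apply,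
      Submodule.Quotient.mk_eq_zero] at hp
    obtain ⟨n, -, hn⟩ := (Submodule.mem_smul_pointwise_iff_exists _ _ _).mp hp
    exact ⟨n, hn⟩
  choose g hg using hmem
  refine ⟨{ toFun := g, map_add' := fun p q => hx ?_, map_smul' := fun r p => hx ?_ }, ?_⟩
  · simp [smul_add, hg]
  · simp only [RingHom.id_apply]
    rw [smul_comm, hg, hg, map_smul]
  · ext p
    exact hg p

lemma isSMulRegular_linearMap {R M N : Type*} [CommRing R] [AddCommGroup M] [Module R M]
    [AddCommGroup N] [Module R N] {x : R} (hx : IsSMulRegular N x) :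
    IsSMulRegular (M →ₗ[R] N) x :=
  fun _ _ h => LinearMap.ext fun m => hx (LinearMap.congr_fun h m)

lemma mkQ_comp_smul_eq_zero {R M N : Type*} [CommRing R] [AddCommGroup M] [Module R M]
    [AddCommGroup N] [Module R N] (x : R) (f : M →ₗ[R] N) :
    (x • (⊤ : Submodule R N)).mkQ ∘ₗ (x • f) = 0 := by
  ext m
  rw [LinearMap.comp_apply, LinearMap.zero_apply, Submodule.mkQ_apply,
    Submodule.Quotient.mk_eq_zero]
  exact Submodule.smul_mem_pointwise_smul _ _ _ trivial

/-- Exactness of `Hom(P₁, N) → Hom(P₂, N) → Hom(P₃, N)` and `Hom(P₂, N) → Hom(P₃, N) → Hom(P₄, N)`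
implies that of `Hom(P₁, N/xN) → Hom(P₂, N/xN) → Hom(P₃, N/xN)`
if `x` is regular on `N` and `P₂` is projective. -/
lemma exact_lcomp_quotSMulTop {R P₁ P₂ P₃ P₄ N : Type*} [CommRing R]
    [AddCommGroup P₁] [Module R P₁] [AddCommGroup P₂] [Module R P₂]
    [AddCommGroup P₃] [Module R P₃] [AddCommGroup P₄] [Module R P₄] [AddCommGroup N] [Module R N]
    [Module.Projective R P₂] {d₁ : P₂ →ₗ[R] P₁} {d₂ : P₃ →ₗ[R] P₂} {d₃ : P₄ →ₗ[R] P₃}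
    (h₁₂ : d₁ ∘ₗ d₂ = 0) (h₂₃ : d₂ ∘ₗ d₃ = 0) {x : R} (hx : IsSMulRegular N x)
    (h : Function.Exact (LinearMap.lcomp R N d₁) (LinearMap.lcomp R N d₂))
    (h' : Function.Exact (LinearMap.lcomp R N d₂) (LinearMap.lcomp R N d₃)) :
    Function.Exact (LinearMap.lcomp R (QuotSMulTop x N) d₁)
      (LinearMap.lcomp R (QuotSMulTop x N) d₂) := by
  intro f
  constructor
  · intro hf
    obtain ⟨g, rfl⟩ := Module.projective_lifting_property (x • (⊤ : Submodule R N)).mkQ f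
      (Submodule.mkQ_surjective _)
    obtain ⟨k, hk⟩ := exists_smul_eq_of_mkQ_comp_eq_zero hx (g ∘ₗ d₂) hf
    obtain ⟨l, rfl⟩ := (h' k).mp <| isSMulRegular_linearMap hx <| by
      change x • (k ∘ₗ d₃) = x • 0
      rw [← LinearMap.smul_comp, hk, LinearMap.comp_assoc, h₂₃, LinearMap.comp_zero, smul_zero]
    obtain ⟨m, hm⟩ := (h (g - x • l)).mp <| by
      change (g - x • l) ∘ₗ d₂ = 0
      rw [LinearMap.sub_comp, ← hk, LinearMap.smul_comp]
      exact sub_self _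
    refine ⟨(x • (⊤ : Submodule R N)).mkQ ∘ₗ m, ?_⟩
    change (x • (⊤ : Submodule R N)).mkQ ∘ₗ (LinearMap.lcomp R N d₁ m) = _
    rw [hm, LinearMap.comp_sub, mkQ_comp_smul_eq_zero, sub_zero]
  · rintro ⟨g, rfl⟩
    change (g ∘ₗ d₁) ∘ₗ d₂ = 0
    rw [LinearMap.comp_assoc, h₁₂, LinearMap.comp_zero]

/-- If `P₂ → P₁ → P₀ → M → 0` is exact with `P₀` projective and `Hom(-, N)` is exact at `P₁`, then
maps `M → N/xN` lift to `N` for every `N`-regular `x`. -/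
lemma exists_mkQ_comp_eq {R P₀ P₁ P₂ M N : Type*} [CommRing R]
    [AddCommGroup P₀] [Module R P₀] [AddCommGroup P₁] [Module R P₁] [AddCommGroup P₂] [Module R P₂]
    [AddCommGroup M] [Module R M] [AddCommGroup N] [Module R N] [Module.Projective R P₀]
    {ε : P₀ →ₗ[R] M} {d₀ : P₁ →ₗ[R] P₀} {d₁ : P₂ →ₗ[R] P₁}
    (hε : Function.Surjective ε) (h₀ : Function.Exact d₀ ε) (h₀₁ : d₀ ∘ₗ d₁ = 0)
    {x : R} (hx : IsSMulRegular N x)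
    (h : Function.Exact (LinearMap.lcomp R N d₀) (LinearMap.lcomp R N d₁))
    (f : M →ₗ[R] QuotSMulTop x N) :
    ∃ g : M →ₗ[R] N, (x • (⊤ : Submodule R N)).mkQ ∘ₗ g = f := by
  obtain ⟨g, hg⟩ := Module.projective_lifting_property (x • (⊤ : Submodule R N)).mkQ (f ∘ₗ ε)
    (Submodule.mkQ_surjective _)
  obtain ⟨k, hk⟩ := exists_smul_eq_of_mkQ_comp_eq_zero hx (g ∘ₗ d₀) <| by
    rw [← LinearMap.comp_assoc, hg, LinearMap.comp_assoc, h₀.linearMap_comp_eq_zero,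
      LinearMap.comp_zero]
  obtain ⟨l, rfl⟩ := (h k).mp <| isSMulRegular_linearMap hx <| by
    change x • (k ∘ₗ d₁) = x • 0
    rw [← LinearMap.smul_comp, hk, LinearMap.comp_assoc, h₀₁, LinearMap.comp_zero, smul_zero]
  have hker : LinearMap.ker ε ≤ LinearMap.ker (g - x • l) := by
    rw [h₀.linearMap_ker_eq, LinearMap.range_le_ker_iff, LinearMap.sub_comp, ← hk,
      LinearMap.smul_comp]
    exact sub_self _
  refine ⟨(LinearMap.ker ε).liftQ (g - x • l) hker ∘ₗ
    (ε.quotKerEquivOfSurjective hε).symm.toLinearMap, ?_⟩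
  rw [← LinearMap.cancel_right hε, ← hg]
  ext p
  have hp : (ε.quotKerEquivOfSurjective hε).symm (ε p) = Submodule.Quotient.mk p := by
    rw [LinearEquiv.symm_apply_eq]
    rfl
  have hz := LinearMap.congr_fun (mkQ_comp_smul_eq_zero x l) p
  simp only [LinearMap.comp_apply, LinearEquiv.coe_coe, hp, Submodule.liftQ_apply,
    LinearMap.sub_apply, map_sub, LinearMap.zero_apply] at hz ⊢
  rw [hz, sub_zero]

lemma nonempty_quotSMulTop_linearMap_equiv {R M N : Type*} [CommRing R]
    [AddCommGroup M] [Module R M] [AddCommGroup N] [Module R N] {x : R} (hx : IsSMulRegular N x)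
    (h : ∀ f : M →ₗ[R] QuotSMulTop x N,
      ∃ g : M →ₗ[R] N, (x • (⊤ : Submodule R N)).mkQ ∘ₗ g = f) :
    Nonempty (QuotSMulTop x (M →ₗ[R] N) ≃ₗ[R] (M →ₗ[R] QuotSMulTop x N)) := by
  let φ : (M →ₗ[R] N) →ₗ[R] (M →ₗ[R] QuotSMulTop x N) :=
    LinearMap.compRight R (x • (⊤ : Submodule R N)).mkQ
  have hker : x • (⊤ : Submodule R (M →ₗ[R] N)) = LinearMap.ker φ := by
    ext f
    rw [Submodule.mem_smul_pointwise_iff_exists, LinearMap.mem_ker]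
    constructor
    · rintro ⟨g, -, rfl⟩
      exact mkQ_comp_smul_eq_zero x g
    · intro hf
      obtain ⟨g, hg⟩ := exists_smul_eq_of_mkQ_comp_eq_zero hx f hf
      exact ⟨g, trivial, hg⟩
  exact ⟨Submodule.quotEquivOfEq _ _ hker ≪≫ₗ φ.quotKerEquivOfSurjective h⟩

end

lemma isWeaklyRegular_linearMap_and_nonempty_equiv {R M : Type*} [CommRing R]
    [AddCommGroup M] [Module R M] (P : ℕ → Type*) [∀ n, AddCommGroup (P n)] [∀ n, Module R (P n)]
    [∀ n, Module.Projective R (P n)] (d : ∀ n, P (n + 1) →ₗ[R] P n) (ε : P 0 →ₗ[R] M)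
    (hd : ∀ n, d n ∘ₗ d (n + 1) = 0) (h₀ : Function.Exact (d 0) ε) (hε : Function.Surjective ε)
    (xs : List R) : ∀ (N : Type*) [AddCommGroup N] [Module R N],
    RingTheory.Sequence.IsWeaklyRegular N xs →
    (∀ n < xs.length,
      Function.Exact (LinearMap.lcomp R N (d n)) (LinearMap.lcomp R N (d (n + 1)))) →
    RingTheory.Sequence.IsWeaklyRegular (M →ₗ[R] N) xs ∧
      Nonempty ((M →ₗ[R] (N ⧸ (Ideal.ofList xs • (⊤ : Submodule R N)))) ≃ₗ[R]
        ((M →ₗ[R] N) ⧸ (Ideal.ofList xs • (⊤ : Submodule R (M →ₗ[R] N))))) := by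
  induction xs with
  | nil =>
    intro N _ _ _ _
    exact ⟨.nil R _, ⟨(Submodule.quotEquivOfEqBot _ (by simp)).congrRight ≪≫ₗ
      (Submodule.quotEquivOfEqBot _ (by simp)).symm⟩⟩
  | cons x xs ih =>
    intro N _ _ hreg hexact
    rw [RingTheory.Sequence.isWeaklyRegular_cons_iff] at hreg ⊢
    obtain ⟨hx, hreg⟩ := hreg
    obtain ⟨e⟩ := nonempty_quotSMulTop_linearMap_equiv hx
      (exists_mkQ_comp_eq hε h₀ (hd 0) hx (hexact 0 (by simp)))
    obtain ⟨hreg', ⟨e'⟩⟩ := ih (QuotSMulTop x N) hreg fun n hn =>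
      exact_lcomp_quotSMulTop (hd n) (hd (n + 1)) hx (hexact n (by simp; lia))
        (hexact (n + 1) (by simpa using hn))
    refine ⟨⟨isSMulRegular_linearMap hx, (e.isWeaklyRegular_congr xs).mpr hreg'⟩, ⟨?_⟩⟩
    exact (Submodule.quotOfListConsSMulTopEquivQuotSMulTopInner N x xs).congrRight ≪≫ₗ e' ≪≫ₗ
      (Submodule.Quotient.equiv _ _ e (by
        rw [Submodule.map_smul'', Submodule.map_top, LinearEquiv.range])).symm ≪≫ₗ
      (Submodule.quotOfListConsSMulTopEquivQuotSMulTopInner (M →ₗ[R] N) x xs).symm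

/-- Vanishing of `Ext^{n+1}(M, N)` is exactness of `Hom(P, N)` in degree `n + 1`, for every
projective resolution `P` of `M`. -/
lemma exact_lcomp_of_subsingleton_extMod {R M N : Type} [CommRing R]
    [AddCommGroup M] [Module R M] [AddCommGroup N] [Module R N]
    (P : ProjectiveResolution (ModuleCat.of R M)) (n : ℕ)
    (h : Subsingleton (extMod R (n + 1) M N)) :
    Function.Exact (LinearMap.lcomp R N (P.complex.d (n + 1) n).hom)
      (LinearMap.lcomp R N (P.complex.d (n + 2) (n + 1)).hom) := by
  have hzero : Limits.IsZero
      ((P.complex.linearYonedaObj R (ModuleCat.of R N)).homology (n + 1)) :=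
    .of_iso (ModuleCat.isZero_of_subsingleton (extMod R (n + 1) M N)) (P.isoExt _ _).symm
  rw [← HomologicalComplex.exactAt_iff_isZero_homology,
    HomologicalComplex.exactAt_iff' _ n (n + 1) (n + 2) (by simp) (by simp),
    ShortComplex.moduleCat_exact_iff] at hzero
  intro f
  constructor
  · intro hf
    obtain ⟨g, hg⟩ := hzero (ModuleCat.ofHom f) (ModuleCat.hom_ext hf)
    exact ⟨g.hom, congrArg ModuleCat.Hom.hom hg⟩
  · rintro ⟨g, rfl⟩
    have hd := congrArg ModuleCat.Hom.hom (P.complex.d_comp_d (n + 2) (n + 1) n)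
    rw [ModuleCat.hom_comp, ModuleCat.hom_zero] at hd
    change (g ∘ₗ _) ∘ₗ _ = 0
    rw [LinearMap.comp_assoc, hd, LinearMap.comp_zero]

theorem regular_sequence_on_hom_and_iso
    (R : Type) [CommRing R] [IsNoetherianRing R] [IsLocalRing R]
    (M N : Type) [AddCommGroup M] [Module R M] [AddCommGroup N] [Module R N]
    [Module.Finite R M] [Module.Finite R N] [Nontrivial M] [Nontrivial N]
    (xs : List R) (hxs : ∀ x ∈ xs, x ∈ IsLocalRing.maximalIdeal R)
    (hreg : RingTheory.Sequence.IsWeaklyRegular N xs)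
    (hhom : Nontrivial (M →ₗ[R] N))
    (hext : ∀ i : ℕ, 1 ≤ i → i ≤ xs.length → Subsingleton (extMod R i M N)) :
    RingTheory.Sequence.IsWeaklyRegular (M →ₗ[R] N) xs ∧
      Nonempty ((M →ₗ[R] (N ⧸ (Ideal.ofList xs • (⊤ : Submodule R N)))) ≃ₗ[R]
        ((M →ₗ[R] N) ⧸ (Ideal.ofList xs • (⊤ : Submodule R (M →ₗ[R] N))))) := by
  let P := projectiveResolution (ModuleCat.of R M)
  have hP (n : ℕ) : Module.Projective R (P.complex.X n) :=
    (IsProjective.iff_projective _).mpr (P.projective n)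
  have hexact := (ShortComplex.ShortExact.moduleCat_exact_iff_function_exact _).mp P.exact₀
  refine isWeaklyRegular_linearMap_and_nonempty_equiv (fun n => P.complex.X n)
    (fun n => (P.complex.d (n + 1) n).hom) (P.π.f 0).hom (fun n => ?_) hexact
    ((ModuleCat.epi_iff_surjective (P.π.f 0)).mp inferInstance) xs N hreg fun n hn =>
      exact_lcomp_of_subsingleton_extMod P n (hext (n + 1) (by lia) hn)
  rw [← ModuleCat.hom_comp, P.complex.d_comp_d, ModuleCat.hom_zero]
end
end

section
/- Let R be a commutative Noetherian local ring of Krull dimension d, let M and N be nonzero finitely generated R-modules, and set t = depth(N). Suppose that Hom_R(M,N) has finite injective dimension as an R-module, that Ext_R^i(M,N) = 0 for all 1 ≤ i ≤ t, and that Ext_R^j(M,R) = 0 for all 1 ≤ j ≤ d. Then M is a free R-module and N has finite injective dimension. -/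
open CategoryTheory

noncomputable section

/-- Vanishing of the `i`-th Ext group of two modules, in terms of the Ext groups of abelian
categories, for which the long exact sequences are available. -/
def ExtVanishes (R : Type) [CommRing R] (i : ℕ) (A B : Type) [AddCommGroup A] [Module R A]
    [AddCommGroup B] [Module R B] : Prop :=
  Subsingleton (Abelian.Ext (ModuleCat.of R A) (ModuleCat.of R B) i)

open scoped Pointwise

section ExtVanishes

variable {R : Type} [CommRing R] {A A' A'' B B' B'' : Type}
  [AddCommGroup A] [Module R A] [AddCommGroup A'] [Module R A'] [AddCommGroup A''] [Module R A'']
  [AddCommGroup B] [Module R B] [AddCommGroup B'] [Module R B'] [AddCommGroup B''] [Module R B'']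

theorem extVanishes_zero_iff : ExtVanishes R 0 A B ↔ Subsingleton (A →ₗ[R] B) :=
  Abelian.Ext.addEquiv₀.subsingleton_congr.trans ModuleCat.homAddEquiv.subsingleton_congr

theorem subsingleton_extMod_iff (i : ℕ) :
    Subsingleton (extMod R i A B) ↔ ExtVanishes R i A B := by
  let P := projectiveResolution (ModuleCat.of R A)
  have key (j : ℕ) (hj : (ComplexShape.up ℕ).prev i = j) : Subsingleton (extMod R i A B) ↔
      ∀ f : P.complex.X i ⟶ ModuleCat.of R B, P.complex.d (i + 1) i ≫ f = 0 →
        ∃ g : P.complex.X j ⟶ ModuleCat.of R B, P.complex.d i j ≫ g = f := by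
    rw [extMod, ← ModuleCat.isZero_iff_subsingleton, (P.isoExt i (ModuleCat.of R B)).isZero_iff,
      ← HomologicalComplex.exactAt_iff_isZero_homology,
      HomologicalComplex.exactAt_iff' _ j i (i + 1) hj (by simp), ShortComplex.moduleCat_exact_iff]
    exact Iff.rfl
  rcases i with - | i
  · rw [key 0 (by simp), extVanishes_zero_iff]
    have hd : P.complex.d 0 0 = 0 := P.complex.shape _ _ (by simp)
    simp only [hd, Limits.zero_comp]
    refine ⟨fun h ↦ subsingleton_of_forall_eq 0 fun φ ↦ ?_, fun h f hf ↦ ?_⟩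
    · let φ' : ((ChainComplex.single₀ (ModuleCat R)).obj (ModuleCat.of R A)).X 0 ⟶
        ModuleCat.of R B := ModuleCat.ofHom φ
      have hφ : P.complex.d 1 0 ≫ P.π.f 0 ≫ φ' = 0 := by
        rw [← Category.assoc, P.complex_d_comp_π_f_zero, Limits.zero_comp]
      obtain ⟨-, h0⟩ := h (P.π.f 0 ≫ φ') hφ
      exact congrArg ModuleCat.Hom.hom
        ((cancel_epi (P.π.f 0)).1 (h0.symm.trans Limits.comp_zero.symm) : φ' = 0)
    · refine ⟨0, ?_⟩
      have : Epi (ShortComplex.mk _ _ P.complex_d_comp_π_f_zero).g :=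
        inferInstanceAs (Epi (P.π.f 0))
      rw [← P.exact₀.g_desc f hf]
      have : P.exact₀.desc f hf = 0 := ModuleCat.hom_ext (Subsingleton.elim (h := h) _ _)
      rw [this, Limits.comp_zero]
  · rw [key i (by simp)]
    refine ⟨fun h ↦ subsingleton_of_forall_eq 0 fun x ↦ ?_, fun h f hf ↦ ?_⟩
    · obtain ⟨f, hf, rfl⟩ := P.extMk_surjective x (i + 2) rfl
      exact (P.extMk_eq_zero_iff f _ rfl hf i rfl).2 (h f hf)
    · exact (P.extMk_eq_zero_iff f _ rfl hf i rfl).1 (Subsingleton.elim (h := h) _ _)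

/-- Ext vanishing passes to retracts in the first variable. -/
theorem ExtVanishes.of_retract_left {i : ℕ} (s : A →ₗ[R] A') (r : A' →ₗ[R] A)
    (h : r ∘ₗ s = LinearMap.id) (hE : ExtVanishes R i A' B) : ExtVanishes R i A B := by
  refine subsingleton_of_forall_eq 0 fun x ↦ ?_
  have h1 : (Abelian.Ext.mk₀ (ModuleCat.ofHom r)).comp x (zero_add i) = 0 :=
    Subsingleton.elim (h := hE) _ _
  have h2 := congrArg (fun y ↦ (Abelian.Ext.mk₀ (ModuleCat.ofHom s)).comp y (zero_add i)) h1
  have h3 : ModuleCat.ofHom s ≫ ModuleCat.ofHom r = 𝟙 (ModuleCat.of R A) := by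
    rw [← ModuleCat.ofHom_comp, h]; rfl
  simpa [Abelian.Ext.mk₀_comp_mk₀_assoc, h3] using h2

/-- Ext vanishing passes to retracts in the second variable. -/
theorem ExtVanishes.of_retract_right {i : ℕ} (s : B →ₗ[R] B') (r : B' →ₗ[R] B)
    (h : r ∘ₗ s = LinearMap.id) (hE : ExtVanishes R i A B') : ExtVanishes R i A B := by
  refine subsingleton_of_forall_eq 0 fun x ↦ ?_
  have h1 : x.comp (Abelian.Ext.mk₀ (ModuleCat.ofHom s)) (add_zero i) = 0 :=
    Subsingleton.elim (h := hE) _ _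
  have h2 := congrArg (fun y ↦ y.comp (Abelian.Ext.mk₀ (ModuleCat.ofHom r)) (add_zero i)) h1
  have h3 : ModuleCat.ofHom s ≫ ModuleCat.ofHom r = 𝟙 (ModuleCat.of R B) := by
    rw [← ModuleCat.ofHom_comp, h]; rfl
  simpa [h3] using h2

theorem ExtVanishes.congr_left {i : ℕ} (e : A ≃ₗ[R] A') (hE : ExtVanishes R i A B) :
    ExtVanishes R i A' B :=
  hE.of_retract_left e.symm.toLinearMap e.toLinearMap (by ext; simp)

theorem extVanishes_succ_of_projective [Module.Projective R A] (i : ℕ) :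
    ExtVanishes R (i + 1) A B :=
  subsingleton_of_forall_eq 0 fun x ↦ Abelian.Ext.eq_zero_of_projective x

/-- The short complex of modules attached to an exact pair of linear maps. -/
def exactPairComplex (f : A →ₗ[R] A') (g : A' →ₗ[R] A'') (hfg : Function.Exact f g) :
    ShortComplex (ModuleCat R) :=
  ModuleCat.shortComplexOfCompEqZero f g hfg.linearMap_comp_eq_zero

theorem exactPairComplex_shortExact {f : A →ₗ[R] A'} {g : A' →ₗ[R] A''}
    (hf : Function.Injective f) (hfg : Function.Exact f g) (hg : Function.Surjective g) :
    (exactPairComplex f g hfg).ShortExact :=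
  ModuleCat.shortComplex_shortExact _ hfg hf hg

section Contravariant

variable {f : A →ₗ[R] A'} {g : A' →ₗ[R] A''}

theorem ExtVanishes.left_middle {i : ℕ} (hf : Function.Injective f) (hfg : Function.Exact f g)
    (hg : Function.Surjective g) (h₁ : ExtVanishes R i A B) (h₃ : ExtVanishes R i A'' B) :
    ExtVanishes R i A' B := by
  refine subsingleton_of_forall_eq 0 fun x ↦ ?_
  obtain ⟨y, hy⟩ := Abelian.Ext.contravariant_sequence_exact₂
    (exactPairComplex_shortExact hf hfg hg) _ x (Subsingleton.elim (h := h₁) _ _)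
  obtain rfl : y = 0 := Subsingleton.elim (h := h₃) y 0
  exact hy.symm.trans (Abelian.Ext.comp_zero ..)

theorem ExtVanishes.left_sub {i : ℕ} (hf : Function.Injective f) (hfg : Function.Exact f g)
    (hg : Function.Surjective g) (h₂ : ExtVanishes R i A' B)
    (h₃ : ExtVanishes R (i + 1) A'' B) : ExtVanishes R i A B := by
  refine subsingleton_of_forall_eq 0 fun x ↦ ?_
  obtain ⟨y, hy⟩ := Abelian.Ext.contravariant_sequence_exact₁
    (exactPairComplex_shortExact hf hfg hg) _ x (add_comm 1 i) (Subsingleton.elim (h := h₃) _ _)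
  obtain rfl : y = 0 := Subsingleton.elim (h := h₂) y 0
  exact hy.symm.trans (Abelian.Ext.comp_zero ..)

theorem ExtVanishes.left_quotient {i : ℕ} (hf : Function.Injective f) (hfg : Function.Exact f g)
    (hg : Function.Surjective g) (h₁ : ExtVanishes R i A B)
    (h₂ : ExtVanishes R (i + 1) A' B) : ExtVanishes R (i + 1) A'' B := by
  refine subsingleton_of_forall_eq 0 fun x ↦ ?_
  obtain ⟨y, hy⟩ := Abelian.Ext.contravariant_sequence_exact₃
    (exactPairComplex_shortExact hf hfg hg) _ x (Subsingleton.elim (h := h₂) _ _) (add_comm 1 i)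
  obtain rfl : y = 0 := Subsingleton.elim (h := h₁) y 0
  exact hy.symm.trans (Abelian.Ext.comp_zero ..)

theorem ExtVanishes.exists_extension (hf : Function.Injective f) (hfg : Function.Exact f g)
    (hg : Function.Surjective g) (h₃ : ExtVanishes R 1 A'' B) (φ : A →ₗ[R] B) :
    ∃ ψ : A' →ₗ[R] B, ψ ∘ₗ f = φ := by
  obtain ⟨y, hy⟩ := Abelian.Ext.contravariant_sequence_exact₁
    (exactPairComplex_shortExact hf hfg hg) _ (Abelian.Ext.mk₀ (ModuleCat.ofHom φ))
    (add_comm 1 0) (Subsingleton.elim (h := h₃) _ _)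
  obtain ⟨ψ, rfl⟩ := Abelian.Ext.addEquiv₀.symm.surjective y
  refine ⟨ψ.hom, ?_⟩
  rw [Abelian.Ext.addEquiv₀_symm_apply, Abelian.Ext.mk₀_comp_mk₀] at hy
  have := Abelian.Ext.addEquiv₀.symm.injective
    (a₁ := ModuleCat.ofHom f ≫ ψ) (a₂ := ModuleCat.ofHom φ) hy
  exact congrArg ModuleCat.Hom.hom this

end Contravariant

section Covariant

variable {f : B →ₗ[R] B'} {g : B' →ₗ[R] B''}

theorem ExtVanishes.right_quotient {i : ℕ} (hf : Function.Injective f) (hfg : Function.Exact f g)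
    (hg : Function.Surjective g) (h₂ : ExtVanishes R i A B')
    (h₁ : ExtVanishes R (i + 1) A B) : ExtVanishes R i A B'' := by
  refine subsingleton_of_forall_eq 0 fun x ↦ ?_
  obtain ⟨y, hy⟩ := Abelian.Ext.covariant_sequence_exact₃ _
    (exactPairComplex_shortExact hf hfg hg) x rfl (Subsingleton.elim (h := h₁) _ _)
  obtain rfl : y = 0 := Subsingleton.elim (h := h₂) y 0
  exact hy.symm.trans (Abelian.Ext.zero_comp ..)

theorem ExtVanishes.exists_lift (hf : Function.Injective f) (hfg : Function.Exact f g)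
    (hg : Function.Surjective g) (h₁ : ExtVanishes R 1 A B) (φ : A →ₗ[R] B'') :
    ∃ ψ : A →ₗ[R] B', g ∘ₗ ψ = φ := by
  obtain ⟨y, hy⟩ := Abelian.Ext.covariant_sequence_exact₃ _
    (exactPairComplex_shortExact hf hfg hg) (Abelian.Ext.mk₀ (ModuleCat.ofHom φ)) rfl
    (Subsingleton.elim (h := h₁) _ _)
  obtain ⟨ψ, rfl⟩ := Abelian.Ext.addEquiv₀.symm.surjective y
  refine ⟨ψ.hom, ?_⟩
  rw [Abelian.Ext.addEquiv₀_symm_apply, Abelian.Ext.mk₀_comp_mk₀] at hy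
  have := Abelian.Ext.addEquiv₀.symm.injective
    (a₁ := ψ ≫ ModuleCat.ofHom g) (a₂ := ModuleCat.ofHom φ) hy
  exact congrArg ModuleCat.Hom.hom this

end Covariant

theorem exact_lsmul_quotSMulTop (x : R) :
    Function.Exact (LinearMap.lsmul R A x)
      (Submodule.mkQ (x • (⊤ : Submodule R A)) : A →ₗ[R] QuotSMulTop x A) := by
  intro a
  simp [Submodule.mem_smul_pointwise_iff_exists]

/-- If `x` is regular on `B` and kills `A`, then the vanishing of `Ext^i(A, B/xB)` implies that
of `Ext^(i+1)(A, B)`. -/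
theorem ExtVanishes.succ_of_quotSMulTop {i : ℕ} {x : R} (hx : IsSMulRegular B x)
    (hA : x ∈ Module.annihilator R A) (h : ExtVanishes R i A (QuotSMulTop x B)) :
    ExtVanishes R (i + 1) A B := by
  refine subsingleton_of_forall_eq 0 fun y ↦ ?_
  have h0 : y.comp (Abelian.Ext.mk₀ (ModuleCat.ofHom (LinearMap.lsmul R B x)))
      (add_zero (i + 1)) = 0 := by
    have e : ModuleCat.ofHom (LinearMap.lsmul R B x) = x • 𝟙 (ModuleCat.of R B) := by
      ext; simp
    rw [e]
    exact DFunLike.congr_fun (congrArg AddCommGrpCat.Hom.hom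
      (Abelian.Ext.postcomp_smul_id_eq_zero_of_mem_annihilator
        (M := ModuleCat.of R B) (N := ModuleCat.of R A) hA (i + 1))) y
  obtain ⟨z, hz⟩ := Abelian.Ext.covariant_sequence_exact₁ _
    (exactPairComplex_shortExact (f := LinearMap.lsmul R B x) hx (exact_lsmul_quotSMulTop x)
      (Submodule.mkQ_surjective _)) y h0 rfl
  obtain rfl : z = 0 := Subsingleton.elim (h := h) z 0
  exact hz.symm.trans (Abelian.Ext.zero_comp ..)

/-- Nakayama's lemma for Ext modules along a regular element of the first variable. -/
theorem ExtVanishes.of_quotSMulTop_left [IsLocalRing R] [IsNoetherianRing R]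
    [Module.Finite R A] [Module.Finite R B] {i : ℕ} {x : R}
    (hx : x ∈ IsLocalRing.maximalIdeal R) (hreg : IsSMulRegular A x)
    (h : ExtVanishes R (i + 1) (QuotSMulTop x A) B) : ExtVanishes R i A B := by
  have surj : ∀ y : Abelian.Ext (ModuleCat.of R A) (ModuleCat.of R B) i, ∃ z, x • z = y := by
    intro y
    obtain ⟨z, hz⟩ : ∃ z : Abelian.Ext (ModuleCat.of R A) (ModuleCat.of R B) i,
        (Abelian.Ext.mk₀ (ModuleCat.ofHom (LinearMap.lsmul R A x))).comp z (zero_add i) = y :=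
      Abelian.Ext.contravariant_sequence_exact₁
        (exactPairComplex_shortExact (f := LinearMap.lsmul R A x) hreg (exact_lsmul_quotSMulTop x)
          (Submodule.mkQ_surjective _)) _ y (add_comm 1 i) (Subsingleton.elim (h := h) _ _)
    refine ⟨z, hz ▸ ?_⟩
    have e : ModuleCat.ofHom (LinearMap.lsmul R A x) = x • 𝟙 (ModuleCat.of R A) := by
      ext; simp
    rw [e, Abelian.Ext.mk₀_smul, Abelian.Ext.smul_comp, Abelian.Ext.mk₀_id_comp]
  have htop : (⊤ : Submodule R (Abelian.Ext (ModuleCat.of R A) (ModuleCat.of R B) i)) = ⊥ := by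
    refine Submodule.eq_bot_of_le_smul_of_le_jacobson_bot (IsLocalRing.maximalIdeal R) _
      Module.Finite.fg_top (fun y _ ↦ ?_) (IsLocalRing.maximalIdeal_le_jacobson _)
    obtain ⟨z, rfl⟩ := surj y
    exact Submodule.smul_mem_smul hx trivial
  exact (Submodule.subsingleton_iff R).mp (subsingleton_of_bot_eq_top htop.symm)

end ExtVanishes

section RegularReduction

open IsLocalRing

variable {R : Type} [CommRing R] [IsNoetherianRing R] [IsLocalRing R]

/-- Either the residue field embeds into a finitely generated module, or some element of the
maximal ideal is regular on it. -/
theorem exists_injective_or_exists_isSMulRegular (N : Type) [AddCommGroup N] [Module R N]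
    [Module.Finite R N] :
    (∃ f : R ⧸ maximalIdeal R →ₗ[R] N, Function.Injective f) ∨
      ∃ x ∈ maximalIdeal R, IsSMulRegular N x := by
  by_cases h : Subsingleton (R ⧸ maximalIdeal R →ₗ[R] N)
  · right
    simpa [Ideal.annihilator_quotient] using IsSMulRegular.subsingleton_linearMap_iff.1 h
  · left
    rw [not_subsingleton_iff_nontrivial] at h
    obtain ⟨f, hf⟩ := exists_ne (0 : R ⧸ maximalIdeal R →ₗ[R] N)
    have : IsSimpleModule R (R ⧸ maximalIdeal R) :=
      isSimpleModule_iff_isCoatom.2 (maximalIdeal.isMaximal R).out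
    exact ⟨f, f.injective_of_ne_zero hf⟩

theorem supportDim_quotSMulTop_le {N : Type} [AddCommGroup N] [Module R N] [Module.Finite R N]
    {x : R} (hx : x ∈ maximalIdeal R) (hreg : IsSMulRegular N x) {m : ℕ}
    (hm : Module.supportDim R N ≤ (m + 1 : ℕ)) :
    Module.supportDim R (QuotSMulTop x N) ≤ m := by
  rw [← Module.supportDim_quotSMulTop_succ_eq_supportDim hreg hx] at hm
  push_cast at hm
  exact ENat.WithBot.add_le_add_one_right_iff.1 hm

theorem not_isSMulRegular_of_supportDim_le_zero {N : Type} [AddCommGroup N] [Module R N]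
    [Module.Finite R N] [Nontrivial N] {x : R} (hx : x ∈ maximalIdeal R)
    (hm : Module.supportDim R N ≤ (0 : ℕ)) : ¬ IsSMulRegular N x := by
  intro hreg
  have := nontrivial_quotSMulTop_of_mem_maximalIdeal N hx
  have hne := Module.supportDim_ne_bot_of_nontrivial R (QuotSMulTop x N)
  rw [← Module.supportDim_quotSMulTop_succ_eq_supportDim hreg hx] at hm
  exact hne ((ENat.WithBot.add_one_le_zero_iff _).1 hm)

theorem exists_not_extVanishes_residue (m : ℕ) (N : Type) [AddCommGroup N] [Module R N]
    [Module.Finite R N] [Nontrivial N] (hm : Module.supportDim R N ≤ m) :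
    ∃ i, ¬ ExtVanishes R i (R ⧸ maximalIdeal R) N := by
  by_contra! h
  induction m generalizing N with
  | zero =>
    obtain ⟨f, hf⟩ | ⟨x, hx, hreg⟩ := exists_injective_or_exists_isSMulRegular (R := R) N
    · have := extVanishes_zero_iff.1 (h 0)
      obtain rfl : f = 0 := Subsingleton.elim _ _
      exact one_ne_zero (hf (a₁ := 1) (a₂ := 0) rfl)
    · exact not_isSMulRegular_of_supportDim_le_zero hx hm hreg
  | succ m ih =>
    obtain ⟨f, hf⟩ | ⟨x, hx, hreg⟩ := exists_injective_or_exists_isSMulRegular (R := R) N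
    · have := extVanishes_zero_iff.1 (h 0)
      obtain rfl : f = 0 := Subsingleton.elim _ _
      exact one_ne_zero (hf (a₁ := 1) (a₂ := 0) rfl)
    · have := nontrivial_quotSMulTop_of_mem_maximalIdeal N hx
      exact ih (QuotSMulTop x N) (supportDim_quotSMulTop_le hx hreg hm) fun i ↦
        .right_quotient (f := LinearMap.lsmul R N x) hreg (exact_lsmul_quotSMulTop x)
          (Submodule.mkQ_surjective _) (h i) (h (i + 1))

theorem exists_injective_residue_of_extVanishes {X : Type} [AddCommGroup X] [Module R X]
    (m c : ℕ) (Q : Type) [AddCommGroup Q] [Module R Q] [Module.Finite R Q] [Nontrivial Q]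
    (hm : Module.supportDim R Q ≤ m) (hQ : ∀ i, c < i → ExtVanishes R i Q X) :
    ∃ (Q' : Type) (_ : AddCommGroup Q') (_ : Module R Q') (_ : Module.Finite R Q')
      (f : R ⧸ maximalIdeal R →ₗ[R] Q'), Function.Injective f ∧
        ∀ i, c + m < i → ExtVanishes R i Q' X := by
  induction m generalizing c Q with
  | zero =>
    obtain ⟨f, hf⟩ | ⟨x, hx, hreg⟩ := exists_injective_or_exists_isSMulRegular (R := R) Q
    · exact ⟨Q, _, _, ‹_›, f, hf, hQ⟩
    · exact absurd hreg (not_isSMulRegular_of_supportDim_le_zero hx hm)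
  | succ m ih =>
    obtain ⟨f, hf⟩ | ⟨x, hx, hreg⟩ := exists_injective_or_exists_isSMulRegular (R := R) Q
    · exact ⟨Q, _, _, ‹_›, f, hf, fun i hi ↦ hQ i (by lia)⟩
    · have := nontrivial_quotSMulTop_of_mem_maximalIdeal Q hx
      obtain ⟨Q', _, _, _, f, hf, h⟩ := ih (c + 1) (QuotSMulTop x Q)
        (supportDim_quotSMulTop_le hx hreg hm) fun i hi ↦ by
          obtain ⟨i, rfl⟩ : ∃ j, i = j + 1 := ⟨i - 1, by lia⟩
          exact .left_quotient (f := LinearMap.lsmul R Q x) hreg (exact_lsmul_quotSMulTop x)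
            (Submodule.mkQ_surjective _) (hQ i (by lia)) (hQ (i + 1) (by lia))
      exact ⟨Q', _, _, ‹_›, f, hf, fun i hi ↦ h i (by lia)⟩

theorem ExtVanishes.of_residue {X : Type} [AddCommGroup X] [Module R X] [Module.Finite R X]
    {n : ℕ} (hk : ExtVanishes R n (R ⧸ maximalIdeal R) X)
    (hsucc : ∀ (L : Type) [AddCommGroup L] [Module R L] [Module.Finite R L],
      ExtVanishes R (n + 1) L X)
    (L : Type) [AddCommGroup L] [Module R L] [Module.Finite R L] : ExtVanishes R n L X := by
  induction ‹Module.Finite R L› using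
    IsNoetherianRing.induction_on_isQuotientEquivQuotientPrime R with
  | subsingleton N => exact hk.of_retract_left 0 0 (Subsingleton.elim _ _)
  | quotient N p e =>
    refine .congr_left e.symm ?_
    by_cases hp : p.1 = maximalIdeal R
    · rwa [hp]
    · obtain ⟨x, hx, hxp⟩ := SetLike.exists_of_lt ((le_maximalIdeal p.2.ne_top).lt_of_ne hp)
      have hreg : IsSMulRegular (R ⧸ p.1) x := by
        rw [isSMulRegular_iff_right_eq_zero_of_smul]
        intro a ha
        obtain ⟨a, rfl⟩ := Ideal.Quotient.mk_surjective a
        rw [Algebra.smul_def, Ideal.Quotient.algebraMap_eq, ← map_mul,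
          Ideal.Quotient.eq_zero_iff_mem] at ha
        exact Ideal.Quotient.eq_zero_iff_mem.2 ((p.2.mem_or_mem ha).resolve_left hxp)
      exact .of_quotSMulTop_left hx hreg (hsucc _)
  | exact N₁ N₂ N₃ f g hf hg hfg h₁ h₃ => exact .left_middle hf hfg hg h₁ h₃

/-- A finitely generated module of finite injective dimension has injective dimension at most the
Krull dimension of the ring. -/
theorem extVanishes_of_ringKrullDim_lt {d : ℕ} (hd : ringKrullDim R = d) {X : Type}
    [AddCommGroup X] [Module R X] [Module.Finite R X] (n : ℕ)
    (h : ∀ (L : Type) [AddCommGroup L] [Module R L] [Module.Finite R L], ∀ i, n < i →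
      ExtVanishes R i L X)
    (L : Type) [AddCommGroup L] [Module R L] [Module.Finite R L] (i : ℕ) (hi : d < i) :
    ExtVanishes R i L X := by
  induction n with
  | zero => exact h L i (by lia)
  | succ n ih =>
    obtain hn | hn := lt_or_ge n d
    · exact h L i (by lia)
    refine ih fun L _ _ _ j hj ↦ ?_
    obtain hj' | rfl : n + 1 < j ∨ j = n + 1 := by lia
    · exact h L j hj'
    refine .of_residue ?_ (fun L _ _ _ ↦ h L (n + 2) (by lia)) L
    obtain ⟨Q, _, _, _, f, hf, hQ⟩ := exists_injective_residue_of_extVanishes (X := X) d 0 R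
      (by rw [Module.supportDim_self_eq_ringKrullDim, hd]) fun i hi ↦ by
        obtain ⟨i, rfl⟩ : ∃ j, i = j + 1 := ⟨i - 1, by lia⟩
        exact extVanishes_succ_of_projective i
    exact .left_sub hf (LinearMap.exact_map_mkQ_range f) (Submodule.mkQ_surjective _)
      (hQ (n + 1) (by lia)) (h _ (n + 2) (by lia))

end RegularReduction

section Transpose

open Module

variable {R : Type} [CommRing R]

theorem LinearMap.exists_comp_eq_of_ker_le {A A' B : Type} [AddCommGroup A] [Module R A]
    [AddCommGroup A'] [Module R A'] [AddCommGroup B] [Module R B] {g : A →ₗ[R] A'}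
    (hg : Function.Surjective g) {u : A →ₗ[R] B} (h : LinearMap.ker g ≤ LinearMap.ker u) :
    ∃ v : A' →ₗ[R] B, v ∘ₗ g = u := by
  refine ⟨(LinearMap.ker g).liftQ u h ∘ₗ (g.quotKerEquivOfSurjective hg).symm.toLinearMap, ?_⟩
  ext a
  have : (g.quotKerEquivOfSurjective hg).symm (g a) = Submodule.Quotient.mk a := by
    rw [LinearEquiv.symm_apply_eq]
    rfl
  simp [this]

theorem exists_comp_eq_of_extVanishes_quotient_range {A A' B : Type} [AddCommGroup A] [Module R A]
    [AddCommGroup A'] [Module R A'] [AddCommGroup B] [Module R B] {g : A →ₗ[R] A'}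
    (hg : ExtVanishes R 1 (A' ⧸ LinearMap.range g) B) {u : A →ₗ[R] B}
    (h : LinearMap.ker g ≤ LinearMap.ker u) : ∃ v : A' →ₗ[R] B, v ∘ₗ g = u := by
  obtain ⟨w, rfl⟩ := LinearMap.exists_comp_eq_of_ker_le g.surjective_rangeRestrict
    (g.ker_rangeRestrict.trans_le h)
  obtain ⟨v, rfl⟩ := ExtVanishes.exists_extension (Submodule.subtype_injective _)
    (LinearMap.exact_subtype_mkQ _) (Submodule.mkQ_surjective _) hg w
  exact ⟨v, rfl⟩

/-- Vanishing of the Ext modules of the transpose of `M` with values in a module `X` for which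
`Ext^i(L, X) = 0` for all finitely generated `L` and all `i > d`. -/
theorem ExtVanishes.transpose [IsNoetherianRing R] {X : Type} [AddCommGroup X] [Module R X] {d : ℕ}
    (hX : ∀ (L : Type) [AddCommGroup L] [Module R L] [Module.Finite R L], ∀ i, d < i →
      ExtVanishes R i L X)
    (c : ℕ) {M F₀ F₁ : Type} [AddCommGroup M] [Module R M] [AddCommGroup F₀] [Module R F₀]
    [AddCommGroup F₁] [Module R F₁] [Module.Free R F₀] [Module.Finite R F₀] [Module.Free R F₁]
    [Module.Finite R F₁] {δ : F₁ →ₗ[R] F₀} {p : F₀ →ₗ[R] M} (hδp : Function.Exact δ p)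
    (hp : Function.Surjective p) (hM : ∀ j, 1 ≤ j → j ≤ c → ExtVanishes R j M R)
    {i : ℕ} (hi : 1 ≤ i) (hic : d < i + c) :
    ExtVanishes R i (Dual R F₁ ⧸ LinearMap.range δ.dualMap) X := by
  induction c generalizing M F₀ F₁ i with
  | zero => exact hX _ i hic
  | succ c ih =>
    obtain ⟨n, q, hq⟩ := Module.Finite.exists_fin' R (LinearMap.ker δ)
    let δ₂ : (Fin n → R) →ₗ[R] F₁ := (LinearMap.ker δ).subtype ∘ₗ q
    have hδ₂ : LinearMap.range δ₂ = LinearMap.ker δ := by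
      rw [LinearMap.range_comp, LinearMap.range_eq_top.2 hq, Submodule.map_top,
        Submodule.range_subtype]
    have hex : Function.Exact (LinearMap.range δ).subtype p := by
      rw [LinearMap.exact_iff, Submodule.range_subtype]
      exact LinearMap.exact_iff.1 hδp
    have hT : ExtVanishes R (i + 1) (Dual R (Fin n → R) ⧸ LinearMap.range δ₂.dualMap) X := by
      refine ih (p := δ.rangeRestrict) ?_ δ.surjective_rangeRestrict (fun j hj hjc ↦ ?_)
        (by lia) (by lia)
      · rw [LinearMap.exact_iff, LinearMap.ker_rangeRestrict, hδ₂]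
      · obtain ⟨j, rfl⟩ : ∃ k, j = k + 1 := ⟨j - 1, by lia⟩
        exact .left_sub (Submodule.subtype_injective _) hex hp (extVanishes_succ_of_projective j)
          (hM (j + 2) (by lia) (by lia))
    have hker : LinearMap.ker δ₂.dualMap ≤ LinearMap.range δ.dualMap := by
      intro u hu
      obtain ⟨v, hv⟩ := LinearMap.exists_comp_eq_of_ker_le (u := u) δ.surjective_rangeRestrict (by
        rw [LinearMap.ker_rangeRestrict, ← hδ₂]
        rintro - ⟨y, rfl⟩
        exact LinearMap.congr_fun hu y)
      obtain ⟨w, rfl⟩ := ExtVanishes.exists_extension (Submodule.subtype_injective _) hex hp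
        (hM 1 le_rfl (by lia)) v
      exact ⟨w, hv⟩
    have hle : LinearMap.range δ.dualMap ≤ LinearMap.ker δ₂.dualMap := by
      rintro - ⟨w, rfl⟩
      ext y
      have : δ (δ₂ (Pi.single y 1)) = 0 := (q (Pi.single y 1)).2
      simp [this]
    obtain ⟨i, rfl⟩ : ∃ k, i = k + 1 := ⟨i - 1, by lia⟩
    refine .left_sub (f := (LinearMap.range δ.dualMap).liftQ δ₂.dualMap hle)
      (g := (LinearMap.range δ₂.dualMap).mkQ) ?_ ?_ (Submodule.mkQ_surjective _)
      (extVanishes_succ_of_projective i) hT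
    · exact LinearMap.ker_eq_bot.1 (Submodule.ker_liftQ_eq_bot _ _ _ hker)
    · rw [LinearMap.exact_iff, Submodule.ker_mkQ, Submodule.range_liftQ]

/-- If the first Ext module of the transpose of `M` with values in `Hom(M, N)` vanishes, then a map
`φ : M → N` killed by the values at `m` of all linear forms on `M` kills `m`. -/
theorem apply_eq_zero_of_extVanishes_transpose {M N F₀ F₁ : Type} [AddCommGroup M] [Module R M]
    [AddCommGroup N] [Module R N] [AddCommGroup F₀] [Module R F₀] [AddCommGroup F₁] [Module R F₁]
    [Module.Free R F₀] [Module.Finite R F₀] [Module.Free R F₁] [Module.Finite R F₁]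
    {δ : F₁ →ₗ[R] F₀} {p : F₀ →ₗ[R] M} (hδp : Function.Exact δ p) (hp : Function.Surjective p)
    (hT : ExtVanishes R 1 (Dual R F₁ ⧸ LinearMap.range δ.dualMap) (M →ₗ[R] N))
    {φ : M →ₗ[R] N} {m : M} (hφ : ∀ f : M →ₗ[R] R, f m • φ = 0) : φ m = 0 := by
  obtain ⟨a, rfl⟩ := hp m
  let g : Dual R F₀ →ₗ[R] (M →ₗ[R] N) :=
    LinearMap.toSpanSingleton R (M →ₗ[R] N) φ ∘ₗ Dual.eval R F₀ a
  obtain ⟨G, hG'⟩ := exists_comp_eq_of_extVanishes_quotient_range hT (u := g) (by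
    intro h hh
    obtain ⟨f, rfl⟩ := LinearMap.exists_comp_eq_of_ker_le (u := h) hp (by
      rw [LinearMap.exact_iff.1 hδp]
      rintro - ⟨y, rfl⟩
      exact LinearMap.congr_fun hh y)
    exact hφ f)
  have hG (h : Dual R F₀) : G (h ∘ₗ δ) = h a • φ := LinearMap.congr_fun hG' h
  let b₀ := Free.chooseBasis R F₀
  let b₁ := Free.chooseBasis R F₁
  calc φ (p a) = ∑ j, (b₀.coord j a • φ) (p (b₀ j)) := by
        conv_lhs => rw [← b₀.sum_repr a]
        simp only [map_sum, map_smul, LinearMap.smul_apply, Basis.coord_apply]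
    _ = ∑ j, ∑ l, G (b₁.coord l) (p (b₀.coord j (δ (b₁ l)) • b₀ j)) := by
        refine Finset.sum_congr rfl fun j _ ↦ ?_
        rw [← hG, ← b₁.sum_dual_apply_smul_coord (b₀.coord j ∘ₗ δ)]
        simp
    _ = ∑ l, G (b₁.coord l) (p (∑ j, b₀.repr (δ (b₁ l)) j • b₀ j)) := by
        rw [Finset.sum_comm]
        simp only [map_sum, Basis.coord_apply]
    _ = 0 := by
        simp [b₀.sum_repr, hδp.apply_apply_eq_zero]

end Transpose

section HomInjDim

open IsLocalRing

variable {R : Type} [CommRing R]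

theorem LinearMap.exact_lsmul_compRight_mkQ {M N : Type} [AddCommGroup M] [Module R M]
    [AddCommGroup N] [Module R N] {x : R} (hx : IsSMulRegular N x) :
    Function.Exact (LinearMap.lsmul R (M →ₗ[R] N) x)
      (LinearMap.compRight R (M := M) (Submodule.mkQ (x • (⊤ : Submodule R N)))) := by
  intro φ
  constructor
  · intro h
    have hφ (m : M) : φ m ∈ LinearMap.range (LinearMap.lsmul R N x) :=
      (exact_lsmul_quotSMulTop x (φ m)).1 (LinearMap.congr_fun h m)
    refine ⟨(LinearEquiv.ofInjective (LinearMap.lsmul R N x) hx).symm.toLinearMap ∘ₗ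
      φ.codRestrict _ hφ, LinearMap.ext fun m ↦ ?_⟩
    exact congrArg Subtype.val
      ((LinearEquiv.ofInjective (LinearMap.lsmul R N x) hx).apply_symm_apply
        (φ.codRestrict _ hφ m))
  · rintro ⟨ψ, rfl⟩
    ext m
    exact (exact_lsmul_quotSMulTop x _).2 ⟨ψ m, rfl⟩

theorem exists_finite_free_presentation [IsNoetherianRing R] (M : Type) [AddCommGroup M]
    [Module R M] [Module.Finite R M] :
    ∃ (a b : ℕ) (δ : (Fin b → R) →ₗ[R] (Fin a → R)) (p : (Fin a → R) →ₗ[R] M),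
      Function.Exact δ p ∧ Function.Surjective p := by
  obtain ⟨a, p, hp⟩ := Module.Finite.exists_fin' R M
  obtain ⟨b, q, hq⟩ := Module.Finite.exists_fin' R (LinearMap.ker p)
  refine ⟨a, b, (LinearMap.ker p).subtype ∘ₗ q, p, ?_, hp⟩
  rw [LinearMap.exact_iff, LinearMap.range_comp, LinearMap.range_eq_top.2 hq, Submodule.map_top,
    Submodule.range_subtype]

variable [IsNoetherianRing R] [IsLocalRing R]

theorem exists_linearMap_residue_ne_zero (M : Type) [AddCommGroup M] [Module R M]
    [Module.Finite R M] [Nontrivial M] : ∃ ψ : M →ₗ[R] R ⧸ maximalIdeal R, ψ ≠ 0 := by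
  by_contra! h
  have : Subsingleton (M →ₗ[R] R ⧸ maximalIdeal R) := subsingleton_of_forall_eq 0 h
  obtain ⟨r, hr, hreg⟩ := IsSMulRegular.subsingleton_linearMap_iff.1 this
  by_cases hm : r ∈ maximalIdeal R
  · refine one_ne_zero (α := R ⧸ maximalIdeal R) (hreg ?_)
    change r • 1 = r • 0
    rw [smul_zero, Algebra.smul_def, mul_one]
    exact Ideal.Quotient.eq_zero_iff_mem.2 hm
  · obtain ⟨m, hm0⟩ := exists_ne (0 : M)
    have hu : IsUnit r := by simpa using hm
    exact hm0 (hu.smul_eq_zero.1 (Module.mem_annihilator.1 hr m))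

theorem exists_linearForm_apply_eq_one_of_injective_residue {M N : Type} [AddCommGroup M]
    [Module R M] [Module.Finite R M] [Nontrivial M] [AddCommGroup N] [Module R N] {d : ℕ}
    (hM : ∀ j, 1 ≤ j → j ≤ d → ExtVanishes R j M R)
    (hX : ∀ (L : Type) [AddCommGroup L] [Module R L] [Module.Finite R L], ∀ i, d < i →
      ExtVanishes R i L (M →ₗ[R] N))
    {ι : R ⧸ maximalIdeal R →ₗ[R] N} (hι : Function.Injective ι) :
    ∃ (f : M →ₗ[R] R) (m : M), f m = 1 := by
  by_contra! h
  have hmem (f : M →ₗ[R] R) (m : M) : f m ∈ maximalIdeal R := by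
    rw [mem_maximalIdeal, mem_nonunits_iff]
    rintro hu
    obtain ⟨u, hu⟩ := hu.exists_left_inv
    exact h f (u • m) (by simpa using hu)
  obtain ⟨ψ, hψ⟩ := exists_linearMap_residue_ne_zero (R := R) M
  obtain ⟨a, b, δ, p, hδp, hp⟩ := exists_finite_free_presentation (R := R) M
  refine hψ (LinearMap.ext fun m ↦ hι ?_)
  rw [LinearMap.zero_apply, map_zero]
  refine apply_eq_zero_of_extVanishes_transpose (φ := ι ∘ₗ ψ) hδp hp
    (.transpose hX d hδp hp hM le_rfl (by lia)) fun f ↦ LinearMap.ext fun m' ↦ ?_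
  have : f m • ψ m' = 0 := by
    obtain ⟨y, hy⟩ := Ideal.Quotient.mk_surjective (ψ m')
    rw [← hy, Algebra.smul_def, Ideal.Quotient.algebraMap_eq,
      Ideal.Quotient.eq_zero_iff_mem.2 (hmem f m), zero_mul]
  rw [LinearMap.smul_apply, LinearMap.comp_apply, ← map_smul, this, map_zero, LinearMap.zero_apply]

/-- A module `M` satisfying the Ext vanishing conditions of the main theorem has a free direct
summand of rank one. -/
theorem exists_linearForm_apply_eq_one {M : Type} [AddCommGroup M] [Module R M] [Module.Finite R M]
    [Nontrivial M] {d : ℕ} (hM : ∀ j, 1 ≤ j → j ≤ d → ExtVanishes R j M R)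
    (t : ℕ) (N : Type) [AddCommGroup N] [Module R N] [Module.Finite R N]
    (ht : ∃ i ≤ t, ¬ ExtVanishes R i (R ⧸ maximalIdeal R) N)
    (hN : ∀ i, 1 ≤ i → i ≤ t → ExtVanishes R i M N)
    (hX : ∀ (L : Type) [AddCommGroup L] [Module R L] [Module.Finite R L], ∀ i, d < i →
      ExtVanishes R i L (M →ₗ[R] N)) :
    ∃ (f : M →ₗ[R] R) (m : M), f m = 1 := by
  induction t generalizing N with
  | zero =>
    obtain ⟨ι, hι⟩ | ⟨x, hx, hreg⟩ := exists_injective_or_exists_isSMulRegular (R := R) N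
    · exact exists_linearForm_apply_eq_one_of_injective_residue hM hX hι
    · obtain ⟨i, hi, hE⟩ := ht
      obtain rfl : i = 0 := by lia
      exact absurd (extVanishes_zero_iff.2 (IsSMulRegular.subsingleton_linearMap_iff.2
        ⟨x, by simpa [Ideal.annihilator_quotient] using hx, hreg⟩)) hE
  | succ t ih =>
    obtain ⟨ι, hι⟩ | ⟨x, hx, hreg⟩ := exists_injective_or_exists_isSMulRegular (R := R) N
    · exact exists_linearForm_apply_eq_one_of_injective_residue hM hX hι
    have hann : x ∈ Module.annihilator R (R ⧸ maximalIdeal R) := by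
      simpa [Ideal.annihilator_quotient] using hx
    have hex := exact_lsmul_quotSMulTop (A := N) x
    have hsurj := Submodule.mkQ_surjective (x • (⊤ : Submodule R N))
    refine ih (QuotSMulTop x N) ?_ (fun i hi hit ↦ ?_) fun L _ _ _ i hi ↦ ?_
    · obtain ⟨i, hi, hE⟩ := ht
      rcases i with - | i
      · exact absurd (extVanishes_zero_iff.2 (IsSMulRegular.subsingleton_linearMap_iff.2
          ⟨x, hann, hreg⟩)) hE
      · exact ⟨i, by lia, fun h ↦ hE (.succ_of_quotSMulTop hreg hann h)⟩
    · exact .right_quotient (f := LinearMap.lsmul R N x) hreg hex hsurj (hN i hi (by lia))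
        (hN (i + 1) (by lia) (by lia))
    · refine .right_quotient (f := LinearMap.lsmul R (M →ₗ[R] N) x) ?_
        (LinearMap.exact_lsmul_compRight_mkQ hreg) (fun φ ↦ ?_) (hX L i hi)
        (hX L (i + 1) (by lia))
      · exact fun φ ψ h ↦ LinearMap.ext fun m ↦ hreg (LinearMap.congr_fun h m)
      · exact ExtVanishes.exists_lift (f := LinearMap.lsmul R N x) hreg hex hsurj
          (hN 1 le_rfl (by lia)) φ

theorem free_or_exists_surjective {M : Type} [AddCommGroup M] [Module R M] [Module.Finite R M]
    {d : ℕ} (hM : ∀ j, 1 ≤ j → j ≤ d → ExtVanishes R j M R)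
    (t : ℕ) (N : Type) [AddCommGroup N] [Module R N] [Module.Finite R N]
    (ht : ∃ i ≤ t, ¬ ExtVanishes R i (R ⧸ maximalIdeal R) N)
    (hN : ∀ i, 1 ≤ i → i ≤ t → ExtVanishes R i M N)
    (hX : ∀ (L : Type) [AddCommGroup L] [Module R L] [Module.Finite R L], ∀ i, d < i →
      ExtVanishes R i L (M →ₗ[R] N)) (k : ℕ) :
    Module.Free R M ∨ ∃ g : M →ₗ[R] (Fin k → R), Function.Surjective g := by
  induction k with
  | zero => exact .inr ⟨0, Function.surjective_to_subsingleton _⟩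
  | succ k ih =>
    obtain h | ⟨g, hg⟩ := ih
    · exact .inl h
    obtain ⟨s, hs⟩ := Module.projective_lifting_property g .id hg
    replace hs (v : Fin k → R) : g (s v) = v := LinearMap.congr_fun hs v
    obtain hK | hK := subsingleton_or_nontrivial (LinearMap.ker g)
    · left
      have hinj : Function.Injective g :=
        LinearMap.ker_eq_bot.1 (Submodule.subsingleton_iff_eq_bot.1 hK)
      exact .of_equiv (LinearEquiv.ofBijective g ⟨hinj, hg⟩).symm
    · right
      let r : M →ₗ[R] LinearMap.ker g :=
        (LinearMap.id - s ∘ₗ g).codRestrict _ fun m ↦ by simp [hs]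
      have hr (y : LinearMap.ker g) : r y = y := Subtype.ext (by simp [r])
      have hrs (v : Fin k → R) : r (s v) = 0 := Subtype.ext (by simp [r, hs])
      have hr' : r ∘ₗ (LinearMap.ker g).subtype = LinearMap.id := LinearMap.ext hr
      obtain ⟨f, y, hy⟩ := exists_linearForm_apply_eq_one (M := LinearMap.ker g)
        (fun j hj hjd ↦ (hM j hj hjd).of_retract_left _ r hr') t N ht
        (fun i hi hit ↦ (hN i hi hit).of_retract_left _ r hr')
        fun L _ _ _ i hi ↦ (hX L i hi).of_retract_right (LinearMap.lcomp R N r)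
          (LinearMap.lcomp R N (LinearMap.ker g).subtype) (by
            ext φ y
            exact congrArg φ (hr y))
      refine ⟨LinearMap.pi (Fin.cons (f ∘ₗ r) fun i ↦ LinearMap.proj i ∘ₗ g), fun v ↦
        ⟨v 0 • y + s (fun i ↦ v i.succ), funext fun i ↦ ?_⟩⟩
      refine Fin.cases ?_ (fun i ↦ ?_) i
      · simp [hr, hrs, hy]
      · simp [hs]

end HomInjDim

theorem free_of_finite_injdim_hom
    (R : Type) [CommRing R] [IsNoetherianRing R] [IsLocalRing R]
    (d : ℕ) (hd : ringKrullDim R = d)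
    (M N : Type) [AddCommGroup M] [Module R M] [AddCommGroup N] [Module R N]
    [Module.Finite R M] [Module.Finite R N] [Nontrivial M] [Nontrivial N]
    (hinj : HasFiniteInjDim R (M →ₗ[R] N))
    (hextN : ∀ i : ℕ, 1 ≤ i → i ≤ moduleDepth R N → Subsingleton (extMod R i M N))
    (hextR : ∀ j : ℕ, 1 ≤ j → j ≤ d → Subsingleton (extMod R j M R)) :
    Module.Free R M ∧ HasFiniteInjDim R N := by
  simp only [subsingleton_extMod_iff] at hextN hextR
  obtain ⟨n, hn⟩ := hinj
  have hX (L : Type) [AddCommGroup L] [Module R L] [Module.Finite R L] (i : ℕ) (hi : d < i) :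
      ExtVanishes R i L (M →ₗ[R] N) :=
    extVanishes_of_ringKrullDim_lt hd n
      (fun L _ _ _ i hi ↦ (subsingleton_extMod_iff i).1 (hn L i hi)) L i hi
  have ht : ∃ i ≤ moduleDepth R N,
      ¬ ExtVanishes R i (R ⧸ IsLocalRing.maximalIdeal R) N := by
    obtain ⟨i, hi⟩ := exists_not_extVanishes_residue d N
      ((Module.supportDim_le_ringKrullDim R N).trans_eq hd)
    exact ⟨_, le_rfl, fun h ↦ Nat.sInf_mem
      (s := {i | ¬ Subsingleton (extMod R i (R ⧸ IsLocalRing.maximalIdeal R) N)})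
      ⟨i, fun h ↦ hi ((subsingleton_extMod_iff i).1 h)⟩ ((subsingleton_extMod_iff _).2 h)⟩
  constructor
  · obtain ⟨a, p, hp⟩ := Module.Finite.exists_fin' R M
    refine (free_or_exists_surjective hextR _ N ht hextN hX (a + 1)).resolve_right ?_
    rintro ⟨g, hg⟩
    have := le_of_fin_surjective R (g ∘ₗ p) (hg.comp hp)
    lia
  · obtain ⟨f, m, hfm⟩ := exists_linearForm_apply_eq_one hextR _ N ht hextN hX
    refine ⟨n, fun L _ _ i hi ↦ (subsingleton_extMod_iff i).2 ?_⟩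
    refine ((subsingleton_extMod_iff i).1 (hn L i hi)).of_retract_right
      (LinearMap.smulRightₗ f) (LinearMap.applyₗ m) ?_
    ext y
    simp [hfm]
end
end

section
/- Let R be a commutative Noetherian local ring of Krull dimension d, let M be a finitely generated R-module, and let N be a nonzero finitely generated Tor-rigid R-module. If Ext_R^i(M,N) = 0 for all 1 ≤ i ≤ d, then Ext_R^j(M,R) = 0 for all 1 ≤ j ≤ d. -/
open CategoryTheory

noncomputable section

lemma exists_finite_free_resolution (R : Type) [CommRing R] [IsNoetherianRing R] (M : Type)
    [AddCommGroup M] [Module R M] [Module.Finite R M] :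
    ∃ (r : ℕ → ℕ) (δ : ∀ n, (Fin (r (n + 1)) → R) →ₗ[R] (Fin (r n) → R))
      (ε : (Fin (r 0) → R) →ₗ[R] M), Function.Surjective ε ∧ Function.Exact (δ 0) ε ∧
        ∀ n, Function.Exact (δ (n + 1)) (δ n) := by
  obtain ⟨r₀, ε, hε⟩ := Module.Finite.exists_fin' R M
  have cover (s : Σ n : ℕ, Submodule R (Fin n → R)) :
      ∃ (m : ℕ) (g : (Fin m → R) →ₗ[R] (Fin s.1 → R)), LinearMap.range g = s.2 := by
    obtain ⟨m, g, hg⟩ := Module.Finite.exists_fin' R s.2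
    exact ⟨m, s.2.subtype ∘ₗ g, by
      rw [LinearMap.range_comp, LinearMap.range_eq_top.2 hg, Submodule.map_top,
        Submodule.range_subtype]⟩
  choose m g hg using cover
  let s : ℕ → Σ n : ℕ, Submodule R (Fin n → R) := fun n ↦
    Nat.rec ⟨r₀, LinearMap.ker ε⟩ (fun _ t ↦ ⟨m t, LinearMap.ker (g t)⟩) n
  refine ⟨fun n ↦ (s n).1, fun n ↦ g (s n), ε, hε, ?_, fun n ↦ ?_⟩
  · exact LinearMap.exact_iff.2 (hg (s 0)).symm
  · exact LinearMap.exact_iff.2 (hg (s (n + 1))).symm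

section

variable {R : Type} [CommRing R] {M : Type} [AddCommGroup M] [Module R M]
  {X : ℕ → Type} [∀ n, AddCommGroup (X n)] [∀ n, Module R (X n)]

/-- The chain complex of an exact sequence of modules. -/
def chainComplexOfExact (δ : ∀ n, X (n + 1) →ₗ[R] X n)
    (h : ∀ n, Function.Exact (δ (n + 1)) (δ n)) : ChainComplex (ModuleCat R) ℕ :=
  ChainComplex.of (fun n ↦ ModuleCat.of R (X n)) (fun n ↦ ModuleCat.ofHom (δ n))
    (fun n ↦ by ext x; exact (h n).apply_apply_eq_zero x)

lemma chainComplexOfExact_d (δ : ∀ n, X (n + 1) →ₗ[R] X n)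
    (h : ∀ n, Function.Exact (δ (n + 1)) (δ n)) (n : ℕ) :
    (chainComplexOfExact δ h).d (n + 1) n = ModuleCat.ofHom (δ n) :=
  ChainComplex.of_d (fun n ↦ ModuleCat.of R (X n)) (fun n ↦ ModuleCat.ofHom (δ n)) n

/-- The projective resolution attached to an exact sequence of projective modules
ending in a surjection onto `M`. -/
def projectiveResolutionOfExact [∀ n, Module.Projective R (X n)]
    (δ : ∀ n, X (n + 1) →ₗ[R] X n) (ε : X 0 →ₗ[R] M) (hε : Function.Surjective ε)
    (h₀ : Function.Exact (δ 0) ε) (h : ∀ n, Function.Exact (δ (n + 1)) (δ n)) :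
    ProjectiveResolution (ModuleCat.of R M) where
  complex := chainComplexOfExact δ h
  projective n := (ModuleCat.of R (X n)).projective_of_categoryTheory_projective
  π := (ChainComplex.toSingle₀Equiv _ _).symm ⟨ModuleCat.ofHom ε, by
    rw [chainComplexOfExact_d δ h 0]; ext x; exact h₀.apply_apply_eq_zero x⟩
  quasiIso := ⟨fun n ↦ by
    cases n with
    | zero =>
      rw [ChainComplex.quasiIsoAt₀_iff, ShortComplex.quasiIso_iff_of_zeros']
      · refine (ShortComplex.exact_and_epi_g_iff_of_iso
          (S₁ := ShortComplex.mk (ModuleCat.ofHom (δ 0)) (ModuleCat.ofHom ε)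
            (by ext x; exact h₀.apply_apply_eq_zero x)) ?_).1 ⟨?_, ?_⟩
        · refine ShortComplex.isoMk (Iso.refl _) (Iso.refl _) (Iso.refl _) ?_ ?_
          · exact (Category.id_comp _).trans
              ((chainComplexOfExact_d δ h 0).trans (Category.comp_id _).symm)
          · exact (Category.id_comp _).trans
              ((ChainComplex.toSingle₀Equiv_symm_apply_f_zero _ _).trans
                (Category.comp_id _).symm)
        · rw [ShortComplex.moduleCat_exact_iff]
          exact fun x hx ↦ (h₀ x).1 hx
        · exact (ModuleCat.epi_iff_surjective _).2 hε
      all_goals rfl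
    | succ n =>
      rw [quasiIsoAt_iff_exactAt' _ _ (ChainComplex.exactAt_succ_single_obj _ _),
        HomologicalComplex.exactAt_iff' _ (n + 1 + 1) (n + 1) n (by simp) (by simp),
        ShortComplex.moduleCat_exact_iff]
      intro x hx
      simp only [HomologicalComplex.sc', HomologicalComplex.shortComplexFunctor',
        chainComplexOfExact_d] at x hx ⊢
      exact (h n _).1 hx⟩

variable [∀ n, Module.Projective R (X n)]

lemma subsingleton_extMod_succ_iff (δ : ∀ n, X (n + 1) →ₗ[R] X n) (ε : X 0 →ₗ[R] M)
    (hε : Function.Surjective ε) (h₀ : Function.Exact (δ 0) ε)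
    (h : ∀ n, Function.Exact (δ (n + 1)) (δ n))
    (N : Type) [AddCommGroup N] [Module R N] (n : ℕ) :
    Subsingleton (extMod R (n + 1) M N) ↔
      Function.Exact (LinearMap.lcomp R N (δ n)) (LinearMap.lcomp R N (δ (n + 1))) := by
  let P := projectiveResolutionOfExact δ ε hε h₀ h
  rw [← ModuleCat.isZero_iff_subsingleton, extMod, (P.isoExt (R := R) (n + 1) _).isZero_iff,
    ← HomologicalComplex.exactAt_iff_isZero_homology,
    HomologicalComplex.exactAt_iff' _ n (n + 1) (n + 1 + 1) (by simp) (by simp),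
    ShortComplex.moduleCat_exact_iff]
  have hd (n : ℕ) : P.complex.d (n + 1) n = ModuleCat.ofHom (δ n) :=
    chainComplexOfExact_d δ h n
  simp only [HomologicalComplex.sc', HomologicalComplex.shortComplexFunctor',
    ChainComplex.linearYonedaObj_d, hd]
  refine ⟨fun H f ↦ ⟨fun hf ↦ ?_, ?_⟩, fun H f hf ↦ ?_⟩
  · obtain ⟨g, hg⟩ := H (ModuleCat.ofHom f) (ModuleCat.hom_ext hf)
    exact ⟨g.hom, congrArg ModuleCat.Hom.hom hg⟩
  · rintro ⟨g, rfl⟩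
    ext x
    simp [(h n).apply_apply_eq_zero]
  · obtain ⟨g, hg⟩ := (H f.hom).1 (congrArg ModuleCat.Hom.hom hf)
    exact ⟨ModuleCat.ofHom g, ModuleCat.hom_ext hg⟩

lemma subsingleton_torMod_succ_iff (δ : ∀ n, X (n + 1) →ₗ[R] X n) (ε : X 0 →ₗ[R] M)
    (hε : Function.Surjective ε) (h₀ : Function.Exact (δ 0) ε)
    (h : ∀ n, Function.Exact (δ (n + 1)) (δ n))
    (N : Type) [AddCommGroup N] [Module R N] (n : ℕ) :
    Subsingleton (torMod R (n + 1) N M) ↔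
      Function.Exact (LinearMap.lTensor N (δ (n + 1))) (LinearMap.lTensor N (δ n)) := by
  let P := projectiveResolutionOfExact δ ε hε h₀ h
  have hd (n : ℕ) : P.complex.d (n + 1) n = ModuleCat.ofHom (δ n) :=
    chainComplexOfExact_d δ h n
  rw [← ModuleCat.isZero_iff_subsingleton, torMod, Tor_obj, 
    (P.isoLeftDerivedObj _ (n + 1)).isZero_iff, HomologicalComplex.homologyFunctor_obj,
    ← HomologicalComplex.exactAt_iff_isZero_homology,
    HomologicalComplex.exactAt_iff' _ (n + 1 + 1) (n + 1) n (by simp) (by simp),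
    ShortComplex.moduleCat_exact_iff]
  simp only [HomologicalComplex.sc', HomologicalComplex.shortComplexFunctor',
    Functor.mapHomologicalComplex_obj_d, hd]
  refine ⟨fun H x ↦ ⟨fun hx ↦ H x hx, ?_⟩, fun H x hx ↦ (H x).1 hx⟩
  rintro ⟨y, rfl⟩
  rw [← LinearMap.comp_apply, ← LinearMap.lTensor_comp, (h n).linearMap_comp_eq_zero]
  simp

end

open TensorProduct

section

variable {R : Type*} [CommRing R] {A B C P Q N : Type*} [AddCommGroup A] [Module R A]
  [AddCommGroup B] [Module R B] [AddCommGroup C] [Module R C] [AddCommGroup P] [Module R P]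
  [AddCommGroup Q] [Module R Q] [AddCommGroup N] [Module R N]

lemma lTensor_rTensor_comm_apply (f : A →ₗ[R] B) (g : P →ₗ[R] Q) (x : A ⊗[R] P) :
    g.lTensor B (f.rTensor P x) = f.rTensor Q (g.lTensor A x) := by
  rw [← LinearMap.comp_apply, ← LinearMap.comp_apply, LinearMap.lTensor_comp_rTensor,
    LinearMap.rTensor_comp_lTensor]

lemma lTensor_apply_lTensor_eq_zero {f : A →ₗ[R] B} {g : B →ₗ[R] C} (h : Function.Exact f g)
    (x : P ⊗[R] A) : g.lTensor P (f.lTensor P x) = 0 := by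
  rw [← LinearMap.comp_apply, ← LinearMap.lTensor_comp, h.linearMap_comp_eq_zero,
    LinearMap.lTensor_zero, LinearMap.zero_apply]

lemma rTensor_apply_rTensor_eq_zero {f : A →ₗ[R] B} {g : B →ₗ[R] C} (h : Function.Exact f g)
    (x : A ⊗[R] P) : g.rTensor P (f.rTensor P x) = 0 := by
  rw [← LinearMap.comp_apply, ← LinearMap.rTensor_comp, h.linearMap_comp_eq_zero,
    LinearMap.rTensor_zero, LinearMap.zero_apply]

variable {X : ℕ → Type*} [∀ n, AddCommGroup (X n)] [∀ n, Module R (X n)]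

/-- If `0 → A → B → C → 0` is exact with `B` flat and `A ⊗ N → B ⊗ N` is injective, then
`Tor₁(C, N)`, computed by a resolution `X` of `N`, vanishes. -/
lemma lTensor_exact_of_rTensor_injective [Module.Flat R B]
    {δ : ∀ n, X (n + 1) →ₗ[R] X n} {ε : X 0 →ₗ[R] N} (hε : Function.Surjective ε)
    (h₀ : Function.Exact (δ 0) ε) (h : ∀ n, Function.Exact (δ (n + 1)) (δ n))
    {f : A →ₗ[R] B} {g : B →ₗ[R] C} (hfg : Function.Exact f g) (hg : Function.Surjective g)
    (hinj : Function.Injective (f.rTensor N)) :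
    Function.Exact ((δ 1).lTensor C) ((δ 0).lTensor C) := by
  intro t
  refine ⟨fun ht ↦ ?_, ?_⟩
  · obtain ⟨b, rfl⟩ := LinearMap.rTensor_surjective (X 1) hg t
    rw [lTensor_rTensor_comm_apply] at ht
    obtain ⟨a, ha⟩ := (rTensor_exact (X 0) hfg hg _).1 ht
    have ha₀ : ε.lTensor A a = 0 := hinj <| by
      rw [← lTensor_rTensor_comm_apply, ha, lTensor_apply_lTensor_eq_zero h₀, map_zero]
    obtain ⟨a', rfl⟩ := (lTensor_exact A h₀ hε a).1 ha₀
    obtain ⟨b', hb'⟩ := (Module.Flat.lTensor_exact B (h 0) (b - f.rTensor _ a')).1 <| by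
      rw [map_sub, lTensor_rTensor_comm_apply, ha, sub_self]
    refine ⟨g.rTensor _ b', ?_⟩
    rw [lTensor_rTensor_comm_apply, hb', map_sub, rTensor_apply_rTensor_eq_zero hfg, sub_zero]
  · rintro ⟨y, rfl⟩
    exact lTensor_apply_lTensor_eq_zero (h 0) y

/-- If `0 → A → B → C → 0` is exact with `B` flat and `Tor₂(C, N) = 0`, then `Tor₁(A, N) = 0`,
both computed by a flat resolution `X` of `N`. -/
lemma lTensor_exact_of_lTensor_exact_succ [Module.Flat R B] [∀ n, Module.Flat R (X n)]
    {δ : ∀ n, X (n + 1) →ₗ[R] X n} (h : ∀ n, Function.Exact (δ (n + 1)) (δ n))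
    {f : A →ₗ[R] B} {g : B →ₗ[R] C} (hf : Function.Injective f) (hfg : Function.Exact f g)
    (hg : Function.Surjective g)
    (hC : Function.Exact ((δ 2).lTensor C) ((δ 1).lTensor C)) :
    Function.Exact ((δ 1).lTensor A) ((δ 0).lTensor A) := by
  intro a
  refine ⟨fun ha ↦ ?_, ?_⟩
  · obtain ⟨b, hb⟩ := (Module.Flat.lTensor_exact B (h 0) (f.rTensor _ a)).1 <| by
      rw [lTensor_rTensor_comm_apply, ha, map_zero]
    obtain ⟨c, hc⟩ := (hC (g.rTensor _ b)).1 <| by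
      rw [lTensor_rTensor_comm_apply, hb, rTensor_apply_rTensor_eq_zero hfg]
    obtain ⟨b', rfl⟩ := LinearMap.rTensor_surjective (X 3) hg c
    obtain ⟨a', ha'⟩ := (rTensor_exact (X 2) hfg hg (b - (δ 2).lTensor B b')).1 <| by
      rw [map_sub, ← lTensor_rTensor_comm_apply, hc, sub_self]
    refine ⟨a', Module.Flat.rTensor_preserves_injective_linearMap f hf ?_⟩
    rw [← lTensor_rTensor_comm_apply, ha', map_sub, hb, lTensor_apply_lTensor_eq_zero (h 1),
      sub_zero]
  · rintro ⟨y, rfl⟩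
    exact lTensor_apply_lTensor_eq_zero (h 0) y

/-- If `0 → A → B → C → 0` is exact and `Tor₁(C, N)`, computed by a flat resolution `X` of `N`,
vanishes, then `A ⊗ N → B ⊗ N` is injective. -/
lemma rTensor_injective_of_lTensor_exact [∀ n, Module.Flat R (X n)]
    {δ : ∀ n, X (n + 1) →ₗ[R] X n} {ε : X 0 →ₗ[R] N} (hε : Function.Surjective ε)
    (h₀ : Function.Exact (δ 0) ε) (h : ∀ n, Function.Exact (δ (n + 1)) (δ n))
    {f : A →ₗ[R] B} {g : B →ₗ[R] C} (hf : Function.Injective f) (hfg : Function.Exact f g)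
    (hg : Function.Surjective g)
    (hC : Function.Exact ((δ 1).lTensor C) ((δ 0).lTensor C)) :
    Function.Injective (f.rTensor N) := by
  rw [injective_iff_map_eq_zero]
  intro z hz
  obtain ⟨a, rfl⟩ := LinearMap.lTensor_surjective A hε z
  rw [← lTensor_rTensor_comm_apply] at hz
  obtain ⟨b, hb⟩ := (lTensor_exact B h₀ hε _).1 hz
  obtain ⟨c, hc⟩ := (hC (g.rTensor _ b)).1 <| by
    rw [lTensor_rTensor_comm_apply, hb, rTensor_apply_rTensor_eq_zero hfg]
  obtain ⟨b', rfl⟩ := LinearMap.rTensor_surjective (X 2) hg c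
  obtain ⟨a', ha'⟩ := (rTensor_exact (X 1) hfg hg (b - (δ 1).lTensor B b')).1 <| by
    rw [map_sub, ← lTensor_rTensor_comm_apply, hc, sub_self]
  have : a = (δ 0).lTensor A a' := by
    refine Module.Flat.rTensor_preserves_injective_linearMap f hf ?_
    rw [← lTensor_rTensor_comm_apply, ha', map_sub, hb, lTensor_apply_lTensor_eq_zero (h 0),
      sub_zero]
  rw [this, lTensor_apply_lTensor_eq_zero h₀]

end

lemma IsLocalRing.subsingleton_of_subsingleton_tensorProduct {R : Type*} [CommRing R]
    [IsLocalRing R] {M N : Type*} [AddCommGroup M] [Module R M] [AddCommGroup N] [Module R N]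
    [Module.Finite R M] [Module.Finite R N] [Nontrivial N] (h : Subsingleton (M ⊗[R] N)) :
    Subsingleton M := by
  obtain ⟨K, hK⟩ := IsCoatomic.exists_coatom (α := Submodule R N)
  have : IsSimpleModule R (N ⧸ K) := isSimpleModule_iff_isCoatom.2 hK
  obtain ⟨I, hI, ⟨e⟩⟩ := isSimpleModule_iff_quot_maximal.1 this
  obtain rfl := IsLocalRing.eq_maximalIdeal hI
  rw [← IsLocalRing.subsingleton_tensorProduct (R := R)]
  let g : N →ₗ[R] IsLocalRing.ResidueField R := e.toLinearMap ∘ₗ K.mkQ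
  have hg : Function.Surjective g := e.surjective.comp K.mkQ_surjective
  have : Subsingleton (M ⊗[R] IsLocalRing.ResidueField R) :=
    (LinearMap.lTensor_surjective M hg).subsingleton
  exact (TensorProduct.comm R (IsLocalRing.ResidueField R) M).toEquiv.subsingleton

lemma IsTorRigid.exact_of_rTensor_exact {R : Type} [CommRing R] [IsNoetherianRing R]
    [IsLocalRing R] {N : Type} [AddCommGroup N] [Module R N] [Module.Finite R N] [Nontrivial N]
    (hrigid : IsTorRigid R N) {D₀ D₁ D₂ : Type} [AddCommGroup D₀] [Module R D₀] [AddCommGroup D₁]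
    [Module R D₁] [AddCommGroup D₂] [Module R D₂] [Module.Finite R D₁] [Module.Finite R D₂]
    [Module.Flat R D₂] {a : D₀ →ₗ[R] D₁} {b : D₁ →ₗ[R] D₂} (hab : b ∘ₗ a = 0)
    (h : Function.Exact (a.rTensor N) (b.rTensor N)) : Function.Exact a b := by
  obtain ⟨r, δ, ε, hε, hδ₀, hδ⟩ := exists_finite_free_resolution R N
  -- `p : coker a → im b` is the surjection with kernel `ker b / im a`.
  let p : (D₁ ⧸ LinearMap.range a) →ₗ[R] LinearMap.range b :=
    (LinearMap.range a).liftQ b.rangeRestrict <| by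
      rintro _ ⟨x, rfl⟩
      exact Subtype.ext (LinearMap.congr_fun hab x)
  have hp : Function.Surjective p := by
    rintro ⟨_, x, rfl⟩
    exact ⟨Submodule.Quotient.mk x, rfl⟩
  have hpb : (LinearMap.range b).subtype ∘ₗ p ∘ₗ (LinearMap.range a).mkQ = b := rfl
  have hinj : Function.Injective (((LinearMap.range b).subtype ∘ₗ p).rTensor N) := by
    rw [injective_iff_map_eq_zero]
    intro z hz
    obtain ⟨x, rfl⟩ := LinearMap.rTensor_surjective N (LinearMap.range a).mkQ_surjective z
    rw [← LinearMap.comp_apply, ← LinearMap.rTensor_comp, LinearMap.comp_assoc, hpb] at hz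
    obtain ⟨y, rfl⟩ := (h x).1 hz
    exact rTensor_apply_rTensor_eq_zero (LinearMap.exact_iff.2 (by simp)) y
  rw [LinearMap.rTensor_comp, LinearMap.coe_comp] at hinj
  have hinj₂ : Function.Injective ((LinearMap.range b).subtype.rTensor N) :=
    hinj.of_comp_right (LinearMap.rTensor_surjective N hp)
  have hY := LinearMap.exact_subtype_mkQ (LinearMap.range b)
  have hsurj := (LinearMap.range b).mkQ_surjective
  have tor₁ := lTensor_exact_of_rTensor_injective (X := fun n ↦ Fin (r n) → R) hε hδ₀ hδ hY hsurj hinj₂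
  rw [← subsingleton_torMod_succ_iff (X := fun n ↦ Fin (r n) → R) δ ε hε hδ₀ hδ] at tor₁
  have tor₂ := hrigid _ inferInstance 1 le_rfl tor₁
  rw [subsingleton_torMod_succ_iff (X := fun n ↦ Fin (r n) → R) δ ε hε hδ₀ hδ] at tor₂
  have tor₁' := lTensor_exact_of_lTensor_exact_succ (X := fun n ↦ Fin (r n) → R) hδ
    (LinearMap.range b).injective_subtype hY hsurj tor₂
  have hE : Function.Injective ((LinearMap.ker p).subtype.rTensor N) :=
    rTensor_injective_of_lTensor_exact (X := fun n ↦ Fin (r n) → R) hε hδ₀ hδ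
      (LinearMap.ker p).injective_subtype (LinearMap.exact_subtype_ker_map p) hp tor₁'
  have hEN : Subsingleton (LinearMap.ker p ⊗[R] N) := by
    refine subsingleton_of_forall_eq 0 fun z ↦ hE (hinj.of_comp ?_)
    rw [rTensor_apply_rTensor_eq_zero (LinearMap.exact_subtype_ker_map p), map_zero, map_zero]
  have hE₀ := IsLocalRing.subsingleton_of_subsingleton_tensorProduct hEN
  refine fun x ↦ ⟨fun hx ↦ ?_, ?_⟩
  · have : (LinearMap.range a).mkQ x = 0 :=
      congrArg Subtype.val (Subsingleton.elim
        (⟨(LinearMap.range a).mkQ x, Subtype.ext hx⟩ : LinearMap.ker p) 0)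
    simpa using this
  · rintro ⟨y, rfl⟩
    exact LinearMap.congr_fun hab y

section

variable {R : Type*} [CommRing R] {F₀ F₁ F₂ : Type*} [AddCommGroup F₀] [Module R F₀]
  [AddCommGroup F₁] [Module R F₁] [AddCommGroup F₂] [Module R F₂] [Module.Free R F₀]
  [Module.Free R F₁] [Module.Free R F₂] [Module.Finite R F₀] [Module.Finite R F₁]
  [Module.Finite R F₂] (N : Type*) [AddCommGroup N] [Module R N]

lemma lcomp_comp_dualTensorHomEquiv (f : F₁ →ₗ[R] F₀) :
    LinearMap.lcomp R N f ∘ₗ (dualTensorHomEquiv R F₀ N).toLinearMap =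
      (dualTensorHomEquiv R F₁ N).toLinearMap ∘ₗ (LinearMap.lcomp R R f).rTensor N := by
  ext
  simp

lemma lcomp_exact_iff_rTensor_exact (f : F₁ →ₗ[R] F₀) (g : F₂ →ₗ[R] F₁) :
    Function.Exact (LinearMap.lcomp R N f) (LinearMap.lcomp R N g) ↔
      Function.Exact ((LinearMap.lcomp R R f).rTensor N) ((LinearMap.lcomp R R g).rTensor N) :=
  Function.Exact.iff_of_ladder_linearEquiv (lcomp_comp_dualTensorHomEquiv N f)
    (lcomp_comp_dualTensorHomEquiv N g)

end

theorem ext_vanishing_from_tor_rigid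
    (R : Type) [CommRing R] [IsNoetherianRing R] [IsLocalRing R]
    (d : ℕ) (hd : ringKrullDim R = d)
    (M N : Type) [AddCommGroup M] [Module R M] [AddCommGroup N] [Module R N]
    [Module.Finite R M] [Module.Finite R N] [Nontrivial N]
    (hrigid : IsTorRigid R N)
    (hext : ∀ i : ℕ, 1 ≤ i → i ≤ d → Subsingleton (extMod R i M N)) :
    ∀ j : ℕ, 1 ≤ j → j ≤ d → Subsingleton (extMod R j M R) := by
  obtain ⟨r, δ, ε, hε, hδ₀, hδ⟩ := exists_finite_free_resolution R M
  rintro (_ | j) hj₁ hj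
  · omega
  have hN := hext (j + 1) hj₁ hj
  rw [subsingleton_extMod_succ_iff (X := fun n ↦ Fin (r n) → R) δ ε hε hδ₀ hδ,
    lcomp_exact_iff_rTensor_exact] at hN
  rw [subsingleton_extMod_succ_iff (X := fun n ↦ Fin (r n) → R) δ ε hε hδ₀ hδ]
  refine hrigid.exact_of_rTensor_exact ?_ hN
  ext φ x
  simp [(hδ j).apply_apply_eq_zero]
end
end
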